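/- Let (R, m, k) be a one-dimensional Cohen-Macaulay local ring with infinite residue field and I an m-primary ideal. Then I is Ulrich (i.e., μ(I) = e(R)) if and only if type(I) = e(R), where e(R) is the Hilbert-Samuel multiplicity. -/

import Mathlib

open CategoryTheory IsLocalRing

universe u

/-- The length of a module, as the Krull dimension of its submodule lattice. -/
noncomputable def rlength (R : Type u) (M : Type*) [Ring R] [AddCommGroup M]
    [Module R M] : WithBot ℕ∞ :=
  Order.krullDim (Submodule R M)

/-- `dim_k Ext^1_R(k, M)` (measured as `R`-length, which agrees with `k`-dimension
since the module is killed by the maximal ideal). -/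
noncomputable def modType (R : Type u) [CommRing R] [IsLocalRing R]
    (M : ModuleCat.{u} R) : WithBot ℕ∞ :=
  rlength R (((_root_.Ext R (ModuleCat.{u} R) 1).obj
    (Opposite.op (ModuleCat.of R (ResidueField R)))).obj M)

/-- The Cohen–Macaulay type of an `m`-primary ideal `I`:  `dim_k Ext^1_R(k, I)`. -/
noncomputable def idealType (R : Type u) [CommRing R] [IsLocalRing R] (I : Ideal R) :
    WithBot ℕ∞ :=
  modType R (ModuleCat.of R I)

/-- The Cohen–Macaulay type of `R/I`: `dim_k Hom_R(k, R/I)`. -/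
noncomputable def quotType (R : Type u) [CommRing R] [IsLocalRing R] (I : Ideal R) :
    WithBot ℕ∞ :=
  rlength R (ResidueField R →ₗ[R] R ⧸ I)

/-- An ideal is `m`-primary iff its radical is the maximal ideal. -/
def IsMPrimary (R : Type u) [CommRing R] [IsLocalRing R] (I : Ideal R) : Prop :=
  I.radical = maximalIdeal R

/-- `I` is Elias if `type(I) = type(R/I)`. -/
def EliasIdeal (R : Type u) [CommRing R] [IsLocalRing R] (I : Ideal R) : Prop :=
  idealType R I = quotType R I

/-- The minimal number of generators, as `dim_k I/mI`. -/
noncomputable def mu (R : Type u) [CommRing R] [IsLocalRing R] (I : Ideal R) :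
    WithBot ℕ∞ :=
  rlength R (I ⧸ (maximalIdeal R • ⊤ : Submodule R I))

/-- `R` has Hilbert–Samuel multiplicity `e`. -/
def HasMultiplicity (R : Type u) [CommRing R] [IsLocalRing R] (e : ℕ) : Prop :=
  ∃ N : ℕ, ∀ n ≥ N,
    rlength R (R ⧸ (maximalIdeal R) ^ (n + 1)) =
      rlength R (R ⧸ (maximalIdeal R) ^ n) + (e : WithBot ℕ∞)

section EakinSathaye

variable {k : Type*} [Field k]

theorem finite_setOf_not_surjective_add_smul {B C : Type*} [AddCommGroup B] [Module k B]
    [AddCommGroup C] [Module k C] [FiniteDimensional k C] {f : B →ₗ[k] C}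
    (hf : Function.Surjective f) (g : B →ₗ[k] C) :
    {t : k | ¬ Function.Surjective (f + t • g)}.Finite := by
  obtain ⟨s, hs⟩ := f.exists_rightInverse_of_surjective (LinearMap.range_eq_top.2 hf)
  refine ((Module.End.finite_hasEigenvalue (g ∘ₗ s)).image fun c ↦ -c⁻¹).subset fun t ht ↦ ?_
  have hinj : ¬ Function.Injective (1 + t • (g ∘ₗ s) : Module.End k C) := fun h ↦ ht fun c ↦ by
    obtain ⟨v, hv⟩ := LinearMap.surjective_of_injective h c
    refine ⟨s v, ?_⟩
    have : f (s v) = v := LinearMap.congr_fun hs v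
    simpa [this] using hv
  rw [← LinearMap.ker_eq_bot, Submodule.eq_bot_iff] at hinj
  push Not at hinj
  obtain ⟨v, hv, hv0⟩ := hinj
  have hv' : v + t • g (s v) = 0 := by simpa using hv
  have ht0 : t ≠ 0 := by rintro rfl; simp_all
  refine ⟨-t⁻¹, Module.End.hasEigenvalue_of_hasEigenvector (x := v)
    ⟨Module.End.mem_eigenspace_iff.2 ?_, hv0⟩, by simp⟩
  rw [eq_comm, neg_smul, ← smul_neg, inv_smul_eq_iff₀ ht0]
  exact (eq_neg_of_add_eq_zero_right hv').symm

theorem finite_setOf_not_surjective_add_smul' {B C : Type*} [AddCommGroup B] [Module k B]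
    [AddCommGroup C] [Module k C] [FiniteDimensional k C] {f : B →ₗ[k] C}
    (hf : Function.Surjective f) (g : B →ₗ[k] C) :
    {t : k | ¬ Function.Surjective (g + t • f)}.Finite := by
  refine (((finite_setOf_not_surjective_add_smul hf g).image fun t ↦ t⁻¹).insert 0).subset
    fun t ht ↦ or_iff_not_imp_left.2 fun ht0 ↦ ⟨t⁻¹, fun h ↦ ht fun c ↦ ?_, inv_inv t⟩
  obtain ⟨b, hb⟩ := h (t⁻¹ • c)
  refine ⟨b, ?_⟩
  replace hb := congrArg (t • ·) hb
  simpa [smul_smul, mul_inv_cancel₀ ht0, add_comm] using hb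

variable {A : Type*} [CommRing A] [Algebra k A]

open Submodule

theorem exists_forall_le_span_singleton_mul [Infinite k] {ι : Type*} (V : Submodule k A)
    (B C : ι → Submodule k A) [∀ i, FiniteDimensional k (C i)] (hBC : ∀ i, V * B i ≤ C i)
    (s : Finset ι) (h : ∀ i ∈ s, ∃ y ∈ V, C i ≤ span k {y} * B i) :
    ∃ y ∈ V, ∀ i ∈ s, C i ≤ span k {y} * B i := by
  classical
  let L (i : ι) (y : V) : B i →ₗ[k] C i :=
    (LinearMap.mulLeft k (y : A)).restrict fun b hb ↦ hBC i (mul_mem_mul y.2 hb)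
  have hL (i : ι) (y : V) : C i ≤ span k {(y : A)} * B i ↔ Function.Surjective (L i y) := by
    refine ⟨fun h c ↦ ?_, fun h c hc ↦ ?_⟩
    · obtain ⟨b, hb, hbc⟩ := mem_span_singleton_mul.1 (h c.2)
      exact ⟨⟨b, hb⟩, Subtype.ext hbc⟩
    · obtain ⟨b, hb⟩ := h ⟨c, hc⟩
      exact mem_span_singleton_mul.2 ⟨b, b.2, congrArg Subtype.val hb⟩
  have hadd (i : ι) (y z : V) (t : k) : L i (y + t • z) = L i y + t • L i z := by
    ext b
    simp [L, add_mul]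
  induction s using Finset.induction_on with
  | empty => exact ⟨0, V.zero_mem, by simp⟩
  | insert a s _ ih =>
    obtain ⟨y, hyV, hy⟩ := ih fun i hi ↦ h i (Finset.mem_insert_of_mem hi)
    obtain ⟨z, hzV, hz⟩ := h a (Finset.mem_insert_self a s)
    lift y to V using hyV
    lift z to V using hzV
    have hfin : (⋃ i ∈ insert a s, {t : k | ¬ Function.Surjective (L i (y + t • z))}).Finite := by
      refine Set.Finite.biUnion (Finset.finite_toSet _) fun i hi ↦ ?_
      simp_rw [hadd]
      obtain rfl | hi := Finset.mem_insert.1 (Finset.mem_coe.1 hi)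
      · exact finite_setOf_not_surjective_add_smul' ((hL i z).1 hz) _
      · exact finite_setOf_not_surjective_add_smul ((hL i y).1 (hy i hi)) _
    obtain ⟨t, ht⟩ := hfin.infinite_compl.nonempty
    refine ⟨_, (y + t • z).2, fun i hi ↦ (hL i _).2 ?_⟩
    by_contra hcon
    exact ht (Set.mem_biUnion (Finset.mem_coe.2 hi) hcon)

/-- A version of the Eakin–Sathaye theorem for reductions generated by one element. -/
theorem add_two_le_finrank_of_forall_not_le [Infinite k] (V : Submodule k A)
    [FiniteDimensional k V] (n : ℕ) (M : Submodule k A) [FiniteDimensional k M]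
    (h : ∀ y ∈ V, ¬ V ^ (n + 1) * M ≤ span k {y} * (V ^ n * M)) :
    n + 2 ≤ Module.finrank k (V ^ (n + 1) * M : Submodule k A) := by
  have hfg (j : ℕ) {N : Submodule k A} (hN : N.FG) :
      FiniteDimensional k (V ^ j * N : Submodule k A) :=
    Module.Finite.iff_fg.2 (((Module.Finite.iff_fg.1 ‹FiniteDimensional k V›).pow j).mul hN)
  have hM : M.FG := Module.Finite.iff_fg.1 ‹_›
  have hle {x : A} (hx : x ∈ V) : span k {x} ≤ V := (span_singleton_le_iff_mem _ _).2 hx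
  induction n generalizing M with
  | zero =>
    rw [zero_add, pow_one] at *
    simp only [pow_zero, one_mul] at h
    have : FiniteDimensional k (V * M : Submodule k A) := pow_one V ▸ hfg 1 hM
    obtain ⟨x, hx, hx0⟩ : ∃ x ∈ V, span k {x} * M ≠ ⊥ := by
      by_contra! hcon
      refine h 0 V.zero_mem (mul_le.2 fun x hx m hm ↦ ?_)
      have hxm : x * m ∈ span k {x} * M := mul_mem_mul (mem_span_singleton_self x) hm
      rw [hcon x hx, mem_bot] at hxm
      rw [hxm]
      exact zero_mem _
    have hlt : span k {x} * M < V * M := lt_of_le_not_ge (mul_le_mul_left (hle hx) _) (h x hx)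
    have hfr := finrank_lt_finrank_of_lt hlt
    have := Module.Finite.iff_fg.2 ((fg_span_singleton (R := k) x).mul hM)
    have := (Module.finrank_pos_iff (R := k) (M := (span k {x} * M : Submodule k A))).2
      ((nontrivial_iff_ne_bot).2 hx0)
    omega
  | succ n ih =>
    have hxM (x : A) : (span k {x} * M).FG := (fg_span_singleton x).mul hM
    obtain ⟨x, hx, hxn⟩ : ∃ x ∈ V, ∀ y ∈ V,
        ¬ V ^ (n + 1) * (span k {x} * M) ≤ span k {y} * (V ^ n * (span k {x} * M)) := by
      by_contra! hcon
      obtain ⟨s, hs⟩ : V.FG := Module.Finite.iff_fg.1 ‹_›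
      have (x : A) := hfg (n + 1) (hxM x)
      obtain ⟨y, hy, hys⟩ := exists_forall_le_span_singleton_mul V
        (fun x ↦ V ^ n * (span k {x} * M)) (fun x ↦ V ^ (n + 1) * (span k {x} * M))
        (fun x ↦ by rw [pow_succ', mul_assoc]) s
        (fun x hx ↦ hcon x (hs ▸ subset_span hx))
      refine h y hy ?_
      rw [pow_succ' V (n + 1), mul_assoc]
      nth_rewrite 1 [← hs]
      simp only [span_eq_iSup_of_singleton_spans (s : Set A), iSup_mul, iSup_le_iff]
      intro x hx
      calc span k {x} * (V ^ (n + 1) * M) = V ^ (n + 1) * (span k {x} * M) := by ring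
        _ ≤ span k {y} * (V ^ n * (span k {x} * M)) := hys x hx
        _ = span k {y} * (span k {x} * (V ^ n * M)) := by ring
        _ ≤ span k {y} * (V * (V ^ n * M)) := by
          gcongr
          exact hle (hs ▸ subset_span hx)
        _ = span k {y} * (V ^ (n + 1) * M) := by ring
    have := Module.Finite.iff_fg.2 (hxM x)
    have hrank := ih (span k {x} * M) hxn (hxM x)
    have := hfg (n + 1 + 1) hM
    have hlt : V ^ (n + 1) * (span k {x} * M) < V ^ (n + 1 + 1) * M := by
      have heq : V ^ (n + 1) * (span k {x} * M) = span k {x} * (V ^ (n + 1) * M) := by ring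
      rw [heq]
      refine lt_of_le_not_ge ?_ (h x hx)
      rw [pow_succ' V (n + 1), mul_assoc]
      gcongr
      exact hle hx
    have hfr := finrank_lt_finrank_of_lt hlt
    omega

end EakinSathaye
section Ext

open LinearMap
open scoped Pointwise

theorem exists_smul_eq_of_range_le {R P M : Type*} [CommRing R] [AddCommGroup P] [Module R P]
    [AddCommGroup M] [Module R M] {x : R} (hx : IsSMulRegular M x) (g : P →ₗ[R] M)
    (hg : ∀ p, ∃ v, x • v = g p) : ∃ f : P →ₗ[R] M, x • f = g := by
  choose f hf using hg
  exact ⟨{ toFun := f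
           map_add' := fun a b ↦ hx (by simp only [smul_add, hf, map_add])
           map_smul' := fun r a ↦ hx (by
            simp only [RingHom.id_apply, smul_comm x r, hf, map_smul]) }, LinearMap.ext hf⟩

variable {R : Type*} [CommRing R] [IsLocalRing R]

/-- The socle of a module over a local ring: the elements killed by the maximal ideal. -/
def localSocle (R M : Type*) [CommRing R] [IsLocalRing R] [AddCommGroup M] [Module R M] :
    Submodule R M where
  carrier := {v | ∀ y ∈ maximalIdeal R, y • v = 0}
  add_mem' ha hb y hy := by rw [smul_add, ha y hy, hb y hy, add_zero]
  zero_mem' y _ := smul_zero y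
  smul_mem' r v hv y hy := by rw [smul_comm, hv y hy, smul_zero]

theorem mem_localSocle {M : Type*} [AddCommGroup M] [Module R M] {v : M} :
    v ∈ localSocle R M ↔ ∀ y ∈ maximalIdeal R, y • v = 0 := Iff.rfl

theorem nonempty_homology_equiv_localSocle {P₀ P₁ P₂ M : Type*}
    [AddCommGroup P₀] [Module R P₀] [Module.Projective R P₀] [AddCommGroup P₁] [Module R P₁]
    [AddCommGroup P₂] [Module R P₂] [AddCommGroup M] [Module R M]
    (d₂ : P₂ →ₗ[R] P₁) (d₁ : P₁ →ₗ[R] P₀) (π : P₀ →ₗ[R] ResidueField R)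
    (h₁ : Function.Exact d₂ d₁) (h₀ : Function.Exact d₁ π) (hπ : Function.Surjective π)
    {x : R} (hxm : x ∈ maximalIdeal R) (hx : IsSMulRegular M x)
    (N : Submodule R (ker (lcomp R M d₂)))
    (hN : ∀ f, f ∈ N ↔ ∃ g : P₀ →ₗ[R] M, g ∘ₗ d₁ = f.1) :
    Nonempty ((ker (lcomp R M d₂) ⧸ N) ≃ₗ[R]
      localSocle R (M ⧸ (x • ⊤ : Submodule R M))) := by
  have hk {y : R} (hy : y ∈ maximalIdeal R) (r : ResidueField R) : y • r = 0 := by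
    rw [Algebra.smul_def, ResidueField.algebraMap_eq, (residue_eq_zero_iff y).2 hy, zero_mul]
  have hmk (v : M) : (x • ⊤ : Submodule R M).mkQ v = 0 ↔ ∃ w, x • w = v := by
    rw [Submodule.mkQ_apply, Submodule.Quotient.mk_eq_zero, Submodule.mem_smul_pointwise_iff_exists]
    simp
  obtain ⟨e, he⟩ := hπ 1
  have hlift {y : R} (hy : y ∈ maximalIdeal R) (p : P₀) : ∃ c, d₁ c = y • p :=
    (h₀ _).1 (by rw [map_smul, hk hy])
  obtain ⟨s, hs⟩ : ∃ s : P₀ →ₗ[R] P₁, d₁ ∘ₗ s = x • LinearMap.id := by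
    obtain ⟨s, hs⟩ := Module.projective_lifting_property d₁.rangeRestrict
      ((x • LinearMap.id : P₀ →ₗ[R] P₀).codRestrict (range d₁) fun p ↦ hlift hxm p)
      d₁.surjective_rangeRestrict
    exact ⟨s, by ext p; exact congrArg Subtype.val (LinearMap.congr_fun hs p)⟩
  replace hs (p : P₀) : d₁ (s p) = x • p := LinearMap.congr_fun hs p
  have hf {f : P₁ →ₗ[R] M} (hf : f ∈ ker (lcomp R M d₂)) {a b : P₁} (hab : d₁ a = d₁ b) :
      f a = f b := by
    obtain ⟨c, hc⟩ := (h₁ (a - b)).1 (by rw [map_sub, hab, sub_self])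
    rw [← sub_eq_zero, ← map_sub, ← hc]
    exact LinearMap.congr_fun hf c
  let Φ : ker (lcomp R M d₂) →ₗ[R] M ⧸ (x • ⊤ : Submodule R M) :=
    (x • ⊤ : Submodule R M).mkQ ∘ₗ applyₗ (s e) ∘ₗ (ker (lcomp R M d₂)).subtype
  have hΦ (f) : Φ f = (x • ⊤ : Submodule R M).mkQ (f.1 (s e)) := rfl
  have hker : N = ker Φ := by
    ext f
    rw [hN, mem_ker, hΦ, hmk]
    constructor
    · rintro ⟨g, hg⟩
      exact ⟨g e, by rw [← hg, LinearMap.comp_apply, hs, map_smul]⟩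
    · rintro ⟨a, ha⟩
      obtain ⟨g, hg⟩ := exists_smul_eq_of_range_le hx (f.1 ∘ₗ s) fun p ↦ by
        obtain ⟨r, hr⟩ := residue_surjective (π p)
        obtain ⟨c, hc⟩ := (h₀ (p - r • e)).1 (by
          rw [map_sub, map_smul, he, Algebra.smul_def, mul_one, ResidueField.algebraMap_eq, hr,
            sub_self])
        refine ⟨r • a + f.1 c, ?_⟩
        rw [smul_add, smul_comm, ha, ← f.1.map_smul r, ← f.1.map_smul x, ← map_add,
          LinearMap.comp_apply]
        refine hf f.2 ?_
        rw [map_add, map_smul, map_smul, hs, hs, hc, smul_sub, smul_comm r x e]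
        abel
      refine ⟨g, LinearMap.ext fun c ↦ hx ?_⟩
      change (x • g) (d₁ c) = x • f.1 c
      rw [hg, LinearMap.comp_apply, ← map_smul]
      exact hf f.2 (by rw [hs, map_smul])
  have hrange : range Φ = localSocle R _ := by
    ext v
    constructor
    · rintro ⟨f, rfl⟩ y hy
      obtain ⟨c, hc⟩ := hlift hy e
      rw [hΦ, ← map_smul, hmk]
      refine ⟨f.1 c, ?_⟩
      rw [← map_smul, ← map_smul]
      exact hf f.2 (by rw [map_smul, map_smul, hc, hs, smul_comm])
    · intro hv
      obtain ⟨ψ, hψ⟩ : ∃ ψ : ResidueField R →ₗ[R] M ⧸ (x • ⊤ : Submodule R M), ψ 1 = v :=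
        ⟨Submodule.liftQ (maximalIdeal R) (toSpanSingleton R _ v) (fun y hy ↦ hv y hy),
          one_smul R v⟩
      obtain ⟨g, hg⟩ := Module.projective_lifting_property (x • ⊤ : Submodule R M).mkQ (ψ ∘ₗ π)
        (Submodule.mkQ_surjective _)
      obtain ⟨f, hfg⟩ := exists_smul_eq_of_range_le hx (g ∘ₗ d₁) fun c ↦ (hmk _).1 (by
        have := LinearMap.congr_fun hg (d₁ c)
        rw [LinearMap.comp_apply, LinearMap.comp_apply, h₀.apply_apply_eq_zero, map_zero] at this
        exact this)
      replace hfg (c : P₁) : x • f c = g (d₁ c) := LinearMap.congr_fun hfg c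
      refine ⟨⟨f, LinearMap.ext fun c ↦ hx ?_⟩, ?_⟩
      · change x • f (d₂ c) = x • (0 : M)
        rw [hfg, h₁.apply_apply_eq_zero, map_zero, smul_zero]
      · have : f (s e) = g e := hx (by
          change x • f (s e) = x • g e
          rw [hfg, hs, map_smul])
        rw [hΦ, this]
        have := LinearMap.congr_fun hg e
        rw [LinearMap.comp_apply, LinearMap.comp_apply, he, hψ] at this
        exact this
  exact ⟨(Submodule.quotEquivOfEq _ _ hker).trans
    (Φ.quotKerEquivRange.trans (LinearEquiv.ofEq _ _ hrange))⟩

theorem nonempty_ext_residueField_equiv_localSocle {R : Type u} [CommRing R] [IsLocalRing R]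
    (M : Type u) [AddCommGroup M] [Module R M] {x : R} (hxm : x ∈ maximalIdeal R)
    (hx : IsSMulRegular M x) :
    Nonempty ((((_root_.Ext R (ModuleCat.{u} R) 1).obj
      (Opposite.op (ModuleCat.of R (ResidueField R)))).obj (ModuleCat.of R M)) ≃ₗ[R]
      localSocle R (M ⧸ (x • ⊤ : Submodule R M))) := by
  let P := projectiveResolution (ModuleCat.of R (ResidueField R))
  let C := P.complex.linearYonedaObj R (ModuleCat.of R M)
  have : Module.Projective R (P.complex.X 0) := (IsProjective.iff_projective _).2 (P.projective 0)
  let d₂ := (P.complex.d 2 1).hom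
  let d₁ := (P.complex.d 1 0).hom
  let π : P.complex.X 0 →ₗ[R] ResidueField R := (P.π.f 0).hom
  have h₁ : Function.Exact d₂ d₁ :=
    (ShortComplex.ShortExact.moduleCat_exact_iff_function_exact _).1 (P.exact_succ 0)
  have h₀ : Function.Exact d₁ π :=
    (ShortComplex.ShortExact.moduleCat_exact_iff_function_exact _).1 P.exact₀
  have hπ : Function.Surjective π := (ModuleCat.epi_iff_surjective (P.π.f 0)).1 inferInstance
  let S := ShortComplex.moduleCatMk (lcomp R M d₁) (lcomp R M d₂) (LinearMap.ext fun f ↦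
    LinearMap.ext fun c ↦ by
      change f (d₁ (d₂ c)) = 0
      rw [h₁.apply_apply_eq_zero, map_zero])
  let E (n : ℕ) : C.X n ≅ ModuleCat.of R (P.complex.X n →ₗ[R] M) :=
    (ModuleCat.homLinearEquiv (S := R) (M := P.complex.X n) (N := ModuleCat.of R M)).toModuleIso
  let iso₁ : C.sc' 0 1 2 ≅ S := ShortComplex.isoMk (E 0) (E 1) (E 2) rfl rfl
  let iso := P.isoExt (R := R) 1 (ModuleCat.of R M) ≪≫
    ShortComplex.homologyMapIso (C.isoSc' 0 1 2 (by simp) (by simp) ≪≫ iso₁) ≪≫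
    S.moduleCatHomologyIso
  obtain ⟨Ψ⟩ := nonempty_homology_equiv_localSocle d₂ d₁ π h₁ h₀ hπ hxm hx
    (range S.moduleCatToCycles) fun f ↦
      ⟨fun ⟨g, hg⟩ ↦ ⟨g, congrArg Subtype.val hg⟩, fun ⟨g, hg⟩ ↦ ⟨g, Subtype.ext hg⟩⟩
  exact ⟨iso.toLinearEquiv.trans Ψ⟩

end Ext
section FiberCone

open Polynomial Submodule

variable {R : Type*} [CommRing R] [IsLocalRing R]

/-- The ideal `⨁ 𝔪ⁱ⁺¹ tⁱ` of the Rees algebra `⨁ 𝔪ⁱ tⁱ` of the maximal ideal `𝔪`. The quotient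
is the associated graded ring of `𝔪`. -/
def reesShiftIdeal (R : Type*) [CommRing R] [IsLocalRing R] :
    Ideal (reesAlgebra (maximalIdeal R)) where
  carrier := {f | ∀ i, f.1.coeff i ∈ maximalIdeal R ^ (i + 1)}
  add_mem' ha hb i := by
    rw [AddMemClass.coe_add, coeff_add]
    exact add_mem (ha i) (hb i)
  zero_mem' i := by simp
  smul_mem' f g hg i := by
    rw [smul_eq_mul, MulMemClass.coe_mul, coeff_mul]
    refine sum_mem fun p hp ↦ ?_
    rw [← Finset.HasAntidiagonal.mem_antidiagonal.1 hp, add_assoc, pow_add]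
    exact Ideal.mul_mem_mul (f.2 _) (hg _)

/-- The associated graded ring `⨁ 𝔪ⁱ / 𝔪ⁱ⁺¹` of the maximal ideal `𝔪`. -/
def AssocGradedRing (R : Type*) [CommRing R] [IsLocalRing R] : Type _ :=
  reesAlgebra (maximalIdeal R) ⧸ reesShiftIdeal R

noncomputable instance : CommRing (AssocGradedRing R) :=
  inferInstanceAs (CommRing (reesAlgebra (maximalIdeal R) ⧸ reesShiftIdeal R))

noncomputable instance : Algebra R (AssocGradedRing R) :=
  inferInstanceAs (Algebra R (reesAlgebra (maximalIdeal R) ⧸ reesShiftIdeal R))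

noncomputable instance : Algebra (ResidueField R) (AssocGradedRing R) :=
  RingHom.toAlgebra (S := AssocGradedRing R) <| Ideal.Quotient.lift (maximalIdeal R)
    (algebraMap R (AssocGradedRing R)) fun r hr ↦ Ideal.Quotient.eq_zero_iff_mem.2 fun i ↦ by
      change (C r).coeff i ∈ _
      rw [coeff_C]
      split_ifs with hi
      · simpa [hi] using hr
      · exact zero_mem _

instance : IsScalarTower R (ResidueField R) (AssocGradedRing R) :=
  IsScalarTower.of_algebraMap_eq fun _ ↦ rfl

/-- The class of `r tⁿ` in the associated graded ring, for `r ∈ 𝔪ⁿ`. -/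
noncomputable def leadingForm (R : Type*) [CommRing R] [IsLocalRing R] (n : ℕ) :
    (maximalIdeal R ^ n : Ideal R) →ₗ[R] AssocGradedRing R :=
  (Ideal.Quotient.mkₐ R (reesShiftIdeal R)).toLinearMap ∘ₗ
    ((monomial n).comp (Submodule.subtype _)).codRestrict
      (Subalgebra.toSubmodule (reesAlgebra (maximalIdeal R)))
      fun r ↦ reesAlgebra.monomial_mem.2 r.2

theorem leadingForm_eq_zero_iff {n : ℕ} (r : (maximalIdeal R ^ n : Ideal R)) :
    leadingForm R n r = 0 ↔ (r : R) ∈ maximalIdeal R ^ (n + 1) := by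
  refine Ideal.Quotient.eq_zero_iff_mem.trans ⟨fun h ↦ ?_, fun h i ↦ ?_⟩
  · have hn : (monomial n (r : R)).coeff n ∈ maximalIdeal R ^ (n + 1) := h n
    rwa [coeff_monomial_same] at hn
  · change (monomial n (r : R)).coeff i ∈ _
    rw [coeff_monomial]
    split_ifs with hi
    · exact hi ▸ h
    · exact zero_mem _

theorem leadingForm_mul_leadingForm {m n : ℕ} {r s : R} (hr : r ∈ maximalIdeal R ^ m)
    (hs : s ∈ maximalIdeal R ^ n) :
    leadingForm R m ⟨r, hr⟩ * leadingForm R n ⟨s, hs⟩ =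
      leadingForm R (m + n) ⟨r * s, pow_add (maximalIdeal R) m n ▸ Ideal.mul_mem_mul hr hs⟩ := by
  refine (map_mul (Ideal.Quotient.mkₐ R (reesShiftIdeal R)) _ _).symm.trans (congrArg _ ?_)
  exact Subtype.ext (monomial_mul_monomial m n r s)

theorem leadingForm_congr {m n : ℕ} (h : m = n) {r : R} (hr : r ∈ maximalIdeal R ^ m) :
    leadingForm R m ⟨r, hr⟩ = leadingForm R n ⟨r, h ▸ hr⟩ := by
  subst h
  rfl

theorem exists_pow_succ_eq_span_singleton_mul [IsNoetherianRing R] [Infinite (ResidueField R)]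
    (n : ℕ) (hn : Module.length R ((maximalIdeal R ^ (n + 1) : Ideal R) ⧸
      (maximalIdeal R ^ (n + 2)).submoduleOf (maximalIdeal R ^ (n + 1))) < (n + 2 : ℕ)) :
    ∃ x ∈ maximalIdeal R, maximalIdeal R ^ (n + 1) = Ideal.span {x} * maximalIdeal R ^ n := by
  have hsurj : Function.Surjective (algebraMap R (ResidueField R)) := residue_surjective
  let W (j : ℕ) : Submodule (ResidueField R) (AssocGradedRing R) :=
    { LinearMap.range (leadingForm R j) with
      smul_mem' := fun c a ha ↦ by
        obtain ⟨r, rfl⟩ := hsurj c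
        rw [algebraMap_smul]
        exact (LinearMap.range (leadingForm R j)).smul_mem r ha }
  have hWfg (j : ℕ) : (W j).FG := by
    have h : (LinearMap.range (leadingForm R j)).FG := by
      rw [LinearMap.range_eq_map]
      exact (IsNoetherian.noetherian ⊤).map _
    obtain ⟨t, ht⟩ := h
    refine ⟨t, le_antisymm (span_le.2 fun a ha ↦ ?_) fun a ha ↦ ?_⟩
    · exact (ht.le (subset_span ha) :)
    · exact span_le_restrictScalars R (ResidueField R) _ (ht.ge ha)
  have hWmul (j : ℕ) : W 1 * W j = W (1 + j) := by
    refine le_antisymm (mul_le.2 ?_) ?_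
    · rintro _ ⟨r, rfl⟩ _ ⟨s, rfl⟩
      exact ⟨_, (leadingForm_mul_leadingForm r.2 s.2).symm⟩
    · rintro _ ⟨⟨r, hr⟩, rfl⟩
      have hr' := hr
      rw [pow_add] at hr'
      induction hr' using Submodule.mul_induction_on' with
      | mem_mul_mem a ha b hb =>
        rw [← leadingForm_mul_leadingForm ha hb]
        exact mul_mem_mul ⟨_, rfl⟩ ⟨_, rfl⟩
      | add a ha b hb iha ihb =>
        rw [← pow_add] at ha hb
        exact map_add (leadingForm R (1 + j)) ⟨a, ha⟩ ⟨b, hb⟩ ▸ add_mem (iha ha) (ihb hb)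
  have hWpow (j : ℕ) : W 1 ^ j * W 0 = W j := by
    induction j with
    | zero => rw [pow_zero, one_mul]
    | succ j ih => rw [pow_succ', mul_assoc, ih, hWmul, add_comm]
  have := Module.Finite.iff_fg.2 (hWfg 0)
  have := Module.Finite.iff_fg.2 (hWfg 1)
  have := Module.Finite.iff_fg.2 (hWfg (n + 1))
  have hlen : Module.length R ((maximalIdeal R ^ (n + 1) : Ideal R) ⧸
      (maximalIdeal R ^ (n + 2)).submoduleOf (maximalIdeal R ^ (n + 1))) =
      Module.finrank (ResidueField R) (W (n + 1)) := by
    rw [← Module.length_eq_finrank, ← Module.length_eq_of_surjective (S := R) hsurj]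
    have hker : (maximalIdeal R ^ (n + 2)).submoduleOf (maximalIdeal R ^ (n + 1)) =
        LinearMap.ker (leadingForm R (n + 1)) := by
      ext r
      exact (leadingForm_eq_zero_iff r).symm
    rw [hker]
    exact (leadingForm R (n + 1)).quotKerEquivRange.length_eq
  have hex : ∃ y ∈ W 1, W 1 ^ (n + 1) * W 0 ≤ span (ResidueField R) {y} * (W 1 ^ n * W 0) := by
    by_contra! hcon
    have := add_two_le_finrank_of_forall_not_le (W 1) n (W 0) hcon
    rw [hWpow] at this
    rw [hlen, Nat.cast_lt] at hn
    omega
  obtain ⟨_, ⟨⟨x, hx⟩, rfl⟩, hle⟩ := hex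
  rw [hWpow, hWpow] at hle
  have hxm : x ∈ maximalIdeal R := by rwa [pow_one] at hx
  refine ⟨x, hxm, le_antisymm ?_ ?_⟩
  · refine le_of_le_smul_of_le_jacobson_bot (I := maximalIdeal R) (IsNoetherian.noetherian _)
      (IsLocalRing.maximalIdeal_le_jacobson ⊥) fun r hr ↦ ?_
    obtain ⟨_, ⟨⟨s, hs⟩, rfl⟩, hrs⟩ :=
      mem_span_singleton_mul.1 (hle (⟨⟨r, hr⟩, rfl⟩ : leadingForm R (n + 1) ⟨r, hr⟩ ∈ W (n + 1)))
    rw [leadingForm_mul_leadingForm] at hrs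
    have hxs : x * s ∈ maximalIdeal R ^ (n + 1) :=
      pow_succ' (maximalIdeal R) n ▸ Ideal.mul_mem_mul hxm hs
    have heq : leadingForm R (n + 1) (⟨r, hr⟩ - ⟨x * s, hxs⟩) = 0 := by
      rw [map_sub, sub_eq_zero, ← hrs]
      exact (leadingForm_congr (add_comm n 1) hxs).symm
    rw [leadingForm_eq_zero_iff] at heq
    rw [← add_sub_cancel (x * s) r]
    refine add_mem (mem_sup_left ?_) (mem_sup_right ?_)
    · exact Ideal.mul_mem_mul (Ideal.mem_span_singleton_self x) hs
    · rw [smul_eq_mul, ← pow_succ']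
      exact heq
  · rw [pow_succ']
    exact Ideal.mul_mono_left ((Ideal.span_singleton_le_iff_mem _).2 hxm)

end FiberCone

section Multiplicity

open LinearMap Module
open scoped Pointwise nonZeroDivisors

theorem rlength_eq_coe_length (R : Type u) (M : Type*) [Ring R] [AddCommGroup M] [Module R M] :
    rlength R M = Module.length R M :=
  (Module.coe_length R M).symm

theorem length_quotient_eq_add_of_le {R M : Type*} [Ring R] [AddCommGroup M] [Module R M]
    {A B : Submodule R M} (h : A ≤ B) :
    length R (M ⧸ A) = length R (B ⧸ A.submoduleOf B) + length R (M ⧸ B) := by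
  refine length_eq_add_of_exact (Submodule.mapQ _ A B.subtype le_rfl) (Submodule.factor h) ?_
    (Submodule.factor_surjective h) ?_
  · rw [← ker_eq_bot]
    exact Submodule.ker_liftQ_eq_bot' _ _ (by rw [ker_comp, Submodule.ker_mkQ]; rfl)
  · intro y
    obtain ⟨y, rfl⟩ := Submodule.mkQ_surjective _ y
    refine (Submodule.Quotient.mk_eq_zero B).trans
      ⟨fun hy ↦ ⟨Submodule.Quotient.mk ⟨y, hy⟩, rfl⟩, ?_⟩
    rintro ⟨b, hb⟩
    obtain ⟨b, rfl⟩ := Submodule.mkQ_surjective _ b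
    have hb' : (b : M) - y ∈ A := (Submodule.Quotient.eq A).1 hb
    simpa using B.sub_mem b.2 (h hb')

variable {R : Type*} [CommRing R]

theorem length_quotient_span_singleton_mul {x : R} (hx : x ∈ R⁰) (I : Ideal R) :
    length R (R ⧸ Ideal.span {x} * I) = length R (R ⧸ I) + length R (R ⧸ Ideal.span {x}) := by
  have hmem {r : R} : x * r ∈ Ideal.span {x} * I ↔ r ∈ I := by
    rw [Ideal.mem_span_singleton_mul]
    refine ⟨?_, fun h ↦ ⟨r, h, rfl⟩⟩
    rintro ⟨s, hs, h⟩
    rwa [← mul_cancel_left_mem_nonZeroDivisors hx |>.1 h]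
  refine length_eq_add_of_exact
    (Submodule.mapQ I (Ideal.span {x} * I) (mulLeft R x) fun r hr ↦ hmem.2 hr)
    (Submodule.factor Ideal.mul_le_left) ?_ (Submodule.factor_surjective _) ?_
  · rw [← ker_eq_bot]
    refine Submodule.ker_liftQ_eq_bot' _ _ ?_
    ext r
    exact (hmem.symm.trans (Submodule.Quotient.mk_eq_zero _).symm :)
  · intro y
    obtain ⟨y, rfl⟩ := Submodule.mkQ_surjective _ y
    refine (Submodule.Quotient.mk_eq_zero (Ideal.span {x})).trans ?_
    rw [Ideal.mem_span_singleton']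
    constructor
    · rintro ⟨r, rfl⟩
      exact ⟨Submodule.Quotient.mk r, congrArg Submodule.Quotient.mk (mul_comm x r)⟩
    · rintro ⟨r, hr⟩
      obtain ⟨r, rfl⟩ := Submodule.mkQ_surjective _ r
      have hr' : x * r - y ∈ Ideal.span {x} * I := (Submodule.Quotient.eq _).1 hr
      obtain ⟨s, hs⟩ := Ideal.mem_span_singleton'.1 (Ideal.mul_le_left hr')
      exact ⟨r - s, by linear_combination -hs⟩

theorem length_quotient_smul_top_ideal {x : R} (hx : x ∈ R⁰) {I : Ideal R}
    (hI : length R (R ⧸ I) ≠ ⊤) :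
    length R (I ⧸ (x • ⊤ : Submodule R I)) = length R (R ⧸ Ideal.span {x}) := by
  have h : (x • ⊤ : Submodule R I) = (Ideal.span {x} * I).submoduleOf I := by
    ext r
    rw [Submodule.mem_smul_pointwise_iff_exists, Submodule.submoduleOf, Submodule.mem_comap,
      Submodule.subtype_apply, Ideal.mem_span_singleton_mul]
    constructor
    · rintro ⟨s, -, rfl⟩
      exact ⟨s, s.2, rfl⟩
    · rintro ⟨s, hs, hr⟩
      exact ⟨⟨s, hs⟩, trivial, Subtype.ext hr⟩
  have h1 := length_quotient_eq_add_of_le (Ideal.mul_le_right : Ideal.span {x} * I ≤ I)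
  rw [length_quotient_span_singleton_mul hx, add_comm] at h1
  rw [h]
  exact (ENat.add_left_injective_of_ne_top hI h1).symm

theorem length_quotient_pow_maximalIdeal_ne_top [IsLocalRing R] [IsNoetherianRing R]
    [Ring.KrullDimLE 1 R] {z : R} (hzm : z ∈ maximalIdeal R) (hz : z ∈ R⁰) (n : ℕ) :
    length R (R ⧸ maximalIdeal R ^ n) ≠ ⊤ := by
  have h := length_ne_top_iff.2 (isFiniteLength_quotient_span_singleton R (pow_mem hz n))
  have hle : Ideal.span {z ^ n} ≤ maximalIdeal R ^ n :=
    (Ideal.span_singleton_le_iff_mem _).2 (Ideal.pow_mem_pow hzm n)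
  exact ne_top_of_le_ne_top h
    (length_le_of_surjective (Submodule.factor hle) (Submodule.factor_surjective hle))

theorem HasMultiplicity.exists_length_quotient_span_singleton_eq {R : Type u} [CommRing R]
    [IsLocalRing R] [IsNoetherianRing R] [Infinite (ResidueField R)] [Ring.KrullDimLE 1 R]
    {z : R} (hzm : z ∈ maximalIdeal R) (hz : z ∈ R⁰) {e : ℕ} (he : HasMultiplicity R e) :
    ∃ x ∈ maximalIdeal R, x ∈ R⁰ ∧ length R (R ⧸ Ideal.span {x}) = e := by
  obtain ⟨N, hN⟩ := he
  have hfin := length_quotient_pow_maximalIdeal_ne_top hzm hz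
  have hN' (n : ℕ) (hn : N ≤ n) : length R (R ⧸ maximalIdeal R ^ (n + 1)) =
      e + length R (R ⧸ maximalIdeal R ^ n) := by
    have := hN n hn
    rw [rlength_eq_coe_length, rlength_eq_coe_length] at this
    refine Eq.trans ?_ (add_comm _ _)
    exact_mod_cast this
  set n := N + e
  obtain ⟨x, hxm, hx⟩ := exists_pow_succ_eq_span_singleton_mul (R := R) n (by
    have h := hN' (n + 1) (by omega)
    rw [length_quotient_eq_add_of_le (Ideal.pow_le_pow_right (by omega : n + 1 ≤ n + 1 + 1))] at h
    refine (ENat.add_left_injective_of_ne_top (hfin _) h).trans_lt ?_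
    exact_mod_cast (by omega : e < n + 2))
  have hx0 : x ∈ R⁰ := by
    obtain ⟨r, -, hr⟩ := Ideal.mem_span_singleton_mul.1 (hx ▸ Ideal.pow_mem_pow hzm (n + 1))
    have : x * r ∈ R⁰ := hr ▸ pow_mem hz (n + 1)
    exact (mul_mem_nonZeroDivisors.1 this).1
  refine ⟨x, hxm, hx0, ?_⟩
  have h := hN' n (by omega)
  rw [hx, length_quotient_span_singleton_mul hx0, add_comm] at h
  exact ENat.add_left_injective_of_ne_top (hfin _) h

theorem length_quotient_maximalIdeal_smul_top_eq_iff [IsLocalRing R] {M : Type*} [AddCommGroup M]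
    [Module R M] {x : R} (hxm : x ∈ maximalIdeal R)
    (hM : length R (M ⧸ (x • ⊤ : Submodule R M)) ≠ ⊤) :
    length R (M ⧸ (maximalIdeal R • ⊤ : Submodule R M)) =
        length R (M ⧸ (x • ⊤ : Submodule R M)) ↔
      (maximalIdeal R • ⊤ : Submodule R M) ≤ x • ⊤ := by
  have hle : (x • ⊤ : Submodule R M) ≤ maximalIdeal R • ⊤ := by
    rw [← Submodule.ideal_span_singleton_smul]
    exact Submodule.smul_mono_left ((Ideal.span_singleton_le_iff_mem _).2 hxm)
  have h := length_quotient_eq_add_of_le hle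
  rw [← Submodule.submoduleOf_eq_top, ← Submodule.Quotient.subsingleton_iff,
    ← length_eq_zero_iff (R := R)]
  constructor
  · intro h'
    rw [h'] at h
    exact ENat.add_left_injective_of_ne_top hM (h.symm.trans (zero_add _).symm)
  · intro h'
    rw [h, h', zero_add]

theorem localSocle_quotient_eq_top_iff [IsLocalRing R] {M : Type*} [AddCommGroup M] [Module R M]
    (N : Submodule R M) : localSocle R (M ⧸ N) = ⊤ ↔ maximalIdeal R • ⊤ ≤ N := by
  rw [Submodule.smul_le, Submodule.eq_top_iff']
  simp only [mem_localSocle, Submodule.mem_top, forall_const]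
  refine ⟨fun h r hr m ↦ ?_, fun h q r hr ↦ ?_⟩
  · exact (Submodule.Quotient.mk_eq_zero N).1 (h (Submodule.Quotient.mk m) r hr)
  · obtain ⟨m, rfl⟩ := N.mkQ_surjective q
    exact (Submodule.Quotient.mk_eq_zero N).2 (h r hr m)

theorem Submodule.length_eq_length_iff_eq_top {M : Type*} [AddCommGroup M] [Module R M]
    (hM : length R M ≠ ⊤) {N : Submodule R M} : length R N = length R M ↔ N = ⊤ := by
  obtain ⟨_, _⟩ := isFiniteLength_iff_isNoetherian_isArtinian.1 (length_ne_top_iff.1 hM)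
  refine ⟨fun h ↦ ?_, fun h ↦ h ▸ length_top⟩
  by_contra hN
  exact (Submodule.length_lt hN).ne h

end Multiplicity

theorem ulrich_iff_type_eq_mult (R : Type u) [CommRing R] [IsLocalRing R] [IsNoetherianRing R]
    (hdim : ringKrullDim R = 1)
    (hCM : ∃ x ∈ maximalIdeal R, x ∈ nonZeroDivisors R)
    [Infinite (ResidueField R)] (e : ℕ) (he : HasMultiplicity R e)
    (I : Ideal R) (hI : IsMPrimary R I) :
    mu R I = (e : WithBot ℕ∞) ↔ idealType R I = (e : WithBot ℕ∞) := by
  obtain ⟨z, hzm, hz⟩ := hCM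
  have : Ring.KrullDimLE 1 R := Ring.krullDimLE_iff.2 hdim.le
  obtain ⟨x, hxm, hx, hlen⟩ := he.exists_length_quotient_span_singleton_eq hzm hz
  obtain ⟨j, hj⟩ := Ideal.exists_pow_le_of_le_radical_of_fg_radical
    (hI.ge : maximalIdeal R ≤ I.radical) (IsNoetherian.noetherian _)
  have hfin : Module.length R (R ⧸ I) ≠ ⊤ :=
    ne_top_of_le_ne_top (length_quotient_pow_maximalIdeal_ne_top hzm hz j)
      (Module.length_le_of_surjective (Submodule.factor hj) (Submodule.factor_surjective hj))
  have hQ := (length_quotient_smul_top_ideal hx hfin).trans hlen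
  have hQfin := hQ ▸ ENat.natCast_ne_top e
  have hxI : IsSMulRegular I x := fun a b hab ↦
    Subtype.ext ((mul_cancel_left_mem_nonZeroDivisors hx).1 (congrArg Subtype.val hab))
  obtain ⟨f⟩ := nonempty_ext_residueField_equiv_localSocle I hxm hxI
  rw [mu, idealType, modType, rlength_eq_coe_length, rlength_eq_coe_length, f.length_eq]
  change _ = ((e : ℕ∞) : WithBot ℕ∞) ↔ _ = ((e : ℕ∞) : WithBot ℕ∞)
  rw [WithBot.coe_inj, WithBot.coe_inj, ← hQ,
    length_quotient_maximalIdeal_smul_top_eq_iff hxm hQfin,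
    Submodule.length_eq_length_iff_eq_top hQfin, localSocle_quotient_eq_top_iff]
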